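/- Fix a site and let ξ(j) be Bernoulli with success probability p(R_j), where {R_j}_{j≥1} is the environment Markov chain; let S_m be the number of successes before the m-th failure and set I_0 = R_1 and I_m = R_{S_m+m+1} for m ≥ 1. Then {I_m}_{m≥0} is a Markov chain on R with transition matrix Π = (I − D_pK)^{−1}D_{1−p}K and unique stationary distribution π = μ(I − D_pK)/(1 − p̄). Moreover, with g(i) = E_i[G_1] (G_1 the number of successes before the first failure) and 𝐠 the column vector of the g(i), one has 𝐠 = (I − D_pK)^{−1}𝐩 and π·𝐠 = λ = p̄/(1−p̄). -/

import Mathlib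

open MeasureTheory Filter Set Matrix ProbabilityTheory
open scoped Classical

noncomputable section

/-- `K` is a (row-)stochastic matrix. -/
def IsStochastic {n : Type*} [Fintype n] (K : Matrix n n ℝ) : Prop :=
  (∀ i j, 0 ≤ K i j) ∧ ∀ i, ∑ j, K i j = 1

/-- `v` is a probability (row) vector. -/
def IsProbVec {n : Type*} [Fintype n] (v : n → ℝ) : Prop :=
  (∀ i, 0 ≤ v i) ∧ ∑ i, v i = 1

/-- `μ` is a stationary distribution for `K`, i.e. `μ K = μ`. -/
def IsStationaryDist {n : Type*} [Fintype n] (K : Matrix n n ℝ) (μ : n → ℝ) : Prop :=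
  IsProbVec μ ∧ Matrix.vecMul μ K = μ

/-- `μ` is the unique stationary distribution of `K` (equivalent, for a finite chain, to `K`
having a unique closed irreducible subset). -/
def HasUniqueStationaryDist {n : Type*} [Fintype n] (K : Matrix n n ℝ) (μ : n → ℝ) : Prop :=
  IsStationaryDist K μ ∧ ∀ μ' : n → ℝ, IsStationaryDist K μ' → μ' = μ

/-- `(Pm, Rc, ξ)` is the (averaged) law of the environment and coin tosses at a single site:
`Rc` is a Markov chain with transition matrix `K` and initial distribution `η`
(0-based indexing: `Rc j` is `R_{j+1}` of the paper) and, conditionally on the chain, the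
`ξ j` are independent Bernoulli with success probability `p (Rc j)`. -/
def IsCookieSite {N : ℕ} {Ω : Type*} [MeasurableSpace Ω] (Pm : Measure Ω)
    (K : Matrix (Fin N) (Fin N) ℝ) (p η : Fin N → ℝ)
    (Rc : ℕ → Ω → Fin N) (ξ : ℕ → Ω → Bool) : Prop :=
  (∀ j, Measurable (Rc j)) ∧ (∀ j, Measurable (ξ j)) ∧
    ∀ (m : ℕ) (f : ℕ → Fin N) (b : ℕ → Bool),
      (Pm {ω | ∀ j ≤ m, Rc j ω = f j ∧ ξ j ω = b j}).toReal =
        η (f 0) * (∏ j ∈ Finset.range m, K (f j) (f (j + 1))) *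
          ∏ j ∈ Finset.range (m + 1), (if b j then p (f j) else 1 - p (f j))

/-- `numSucc ξx m` = number of successes before the `m`-th failure in the Bernoulli
sequence `ξx` (the quantity `S_m` of the paper). -/
def numSucc (ξx : ℕ → Bool) (m : ℕ) : ℕ :=
  sInf {k | ((Finset.range (k + m)).filter fun j => ξx j = false).card = m}

/-- `numFail ξx m` = number of failures before the `m`-th success in the Bernoulli
sequence `ξx` (the quantity `F_m` of the paper). -/
def numFail (ξx : ℕ → Bool) (m : ℕ) : ℕ :=
  sInf {k | ((Finset.range (k + m)).filter fun j => ξx j = true).card = m}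

/-- The forward branching-like process: `U_0 = y`, `U_i = S^i_{U_{i−1}}`. -/
def Uproc (ξ : ℤ → ℕ → Bool) (y : ℕ) : ℕ → ℕ
  | 0 => y
  | i + 1 => numSucc (ξ ((i : ℤ) + 1)) (Uproc ξ y i)

/-- The backward branching-like process: `V_0 = y`, `V_i = F^i_{V_{i−1}+1}`. -/
def Vproc (ξ : ℤ → ℕ → Bool) (y : ℕ) : ℕ → ℕ
  | 0 => y
  | i + 1 => numFail (ξ ((i : ℤ) + 1)) (Vproc ξ y i + 1)

/-- The chain `I_m = R_{S_m + m + 1}`: the state governing the next Bernoulli trial after the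
`m`-th failure (0-based indexing of `Rc`). -/
def Ichain {Ω : Type*} {N : ℕ} (Rc : ℕ → Ω → Fin N) (ξ : ℕ → Ω → Bool) (ω : Ω) (m : ℕ) :
    Fin N :=
  Rc (numSucc (fun j => ξ j ω) m + m) ω

/-! ### Matrices -/

lemma vecMul_nonneg {ι κ : Type*} [Fintype ι] {v : ι → ℝ} {A : Matrix ι κ ℝ}
    (hv : ∀ i, 0 ≤ v i) (hA : ∀ i j, 0 ≤ A i j) (j : κ) : 0 ≤ (v ᵥ* A) j :=
  Finset.sum_nonneg fun i _ => mul_nonneg (hv i) (hA i j)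

lemma vecMul_le_vecMul {ι κ : Type*} [Fintype ι] {v w : ι → ℝ} {A : Matrix ι κ ℝ}
    (hA : ∀ i j, 0 ≤ A i j) (hvw : ∀ i, v i ≤ w i) (j : κ) : (v ᵥ* A) j ≤ (w ᵥ* A) j :=
  Finset.sum_le_sum fun i _ => mul_le_mul_of_nonneg_right (hvw i) (hA i j)

lemma HasSum.vecMul_apply {ι κ : Type*} [Fintype ι] {a : ℕ → ι → ℝ} {s : ι → ℝ}
    (h : HasSum a s) (A : Matrix ι κ ℝ) (j : κ) :
    HasSum (fun n => (a n ᵥ* A) j) ((s ᵥ* A) j) :=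
  hasSum_sum (f := fun i n => a n i * A i j) fun i _ => (Pi.hasSum.1 h i).mul_right _

/-- Minimum principle for `I − D_p K`. -/
lemma IsStochastic.nonneg_of_mulVec_nonneg {N : ℕ} {K : Matrix (Fin N) (Fin N) ℝ}
    {p : Fin N → ℝ} (hK : IsStochastic K) (hp : ∀ i, p i ∈ Set.Ioo (0 : ℝ) 1) {v : Fin N → ℝ}
    (hv : ∀ i, 0 ≤ ((1 - Matrix.diagonal p * K) *ᵥ v) i) (i : Fin N) : 0 ≤ v i := by
  have : Nonempty (Fin N) := ⟨i⟩
  obtain ⟨a, ha⟩ := Finite.exists_min v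
  have h1 := hv a
  have h2 : ((1 - Matrix.diagonal p * K) *ᵥ v) a = v a - p a * ∑ j, K a j * v j := by
    rw [Matrix.sub_mulVec, Matrix.one_mulVec, ← Matrix.mulVec_mulVec, Pi.sub_apply,
      Matrix.mulVec_diagonal]
    rfl
  have h3 : v a ≤ ∑ j, K a j * v j := by
    calc v a = ∑ j, K a j * v a := by rw [← Finset.sum_mul, hK.2, one_mul]
      _ ≤ _ := Finset.sum_le_sum fun j _ => mul_le_mul_of_nonneg_left (ha j) (hK.1 a j)
  have h4 := hp a
  have h5 : p a * v a ≤ p a * ∑ j, K a j * v j := mul_le_mul_of_nonneg_left h3 h4.1.le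
  have h6 : 0 ≤ (1 - p a) * v a := by linarith
  exact (nonneg_of_mul_nonneg_right h6 (by linarith [h4.2])).trans (ha i)

lemma IsStochastic.isUnit_det {N : ℕ} {K : Matrix (Fin N) (Fin N) ℝ}
    {p : Fin N → ℝ} (hK : IsStochastic K) (hp : ∀ i, p i ∈ Set.Ioo (0 : ℝ) 1) :
    IsUnit (1 - Matrix.diagonal p * K).det := by
  rw [← Matrix.isUnit_iff_isUnit_det, ← Matrix.mulVec_injective_iff_isUnit]
  intro v w hvw
  have h : ∀ u u' : Fin N → ℝ, (1 - Matrix.diagonal p * K) *ᵥ u =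
      (1 - Matrix.diagonal p * K) *ᵥ u' → ∀ i, u' i ≤ u i := by
    intro u u' huu i
    have := hK.nonneg_of_mulVec_nonneg hp (v := u - u')
      (by intro i; rw [Matrix.mulVec_sub, huu, sub_self]; exact le_rfl) i
    simpa using this
  exact funext fun i => le_antisymm (h w v hvw.symm i) (h v w hvw i)

lemma IsStochastic.inv_nonneg {N : ℕ} {K : Matrix (Fin N) (Fin N) ℝ}
    {p : Fin N → ℝ} (hK : IsStochastic K) (hp : ∀ i, p i ∈ Set.Ioo (0 : ℝ) 1) (i j : Fin N) :
    0 ≤ (1 - Matrix.diagonal p * K)⁻¹ i j := by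
  refine hK.nonneg_of_mulVec_nonneg hp
    (v := (1 - Matrix.diagonal p * K)⁻¹ *ᵥ Pi.single j 1) (fun k => ?_) i |>.trans_eq ?_
  · rw [Matrix.mulVec_mulVec, Matrix.mul_nonsing_inv _ (hK.isUnit_det hp), Matrix.one_mulVec]
    exact (Pi.single_nonneg.2 (zero_le_one (α := ℝ)) : (0 : Fin N → ℝ) ≤ Pi.single j 1) k
  · simp

lemma IsStochastic.mulVec_one {N : ℕ} {K : Matrix (Fin N) (Fin N) ℝ} (hK : IsStochastic K) :
    K *ᵥ 1 = 1 := by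
  ext i
  simpa [Matrix.mulVec, dotProduct] using hK.2 i

lemma one_sub_diagonal_mul {N : ℕ} (K : Matrix (Fin N) (Fin N) ℝ) (p : Fin N → ℝ) :
    Matrix.diagonal (fun i => 1 - p i) * K = K - Matrix.diagonal p * K := by
  have : Matrix.diagonal (fun i => 1 - p i) = 1 - Matrix.diagonal p := by
    rw [← Matrix.diagonal_one, Matrix.diagonal_sub]
  rw [this, sub_mul, one_mul]

/-- `v (I − D_p K) 1 = 1 − v·p` for a stochastic matrix `K`. -/
lemma IsStochastic.sum_vecMul_one_sub {N : ℕ} {K : Matrix (Fin N) (Fin N) ℝ}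
    (hK : IsStochastic K) (p v : Fin N → ℝ) :
    ∑ i, (v ᵥ* (1 - Matrix.diagonal p * K)) i = ∑ i, v i - ∑ i, v i * p i := by
  have h : ∑ i, (v ᵥ* (1 - Matrix.diagonal p * K)) i =
      (v ᵥ* (1 - Matrix.diagonal p * K)) ⬝ᵥ 1 := by simp [dotProduct]
  rw [h, ← Matrix.dotProduct_mulVec, Matrix.sub_mulVec, ← Matrix.mulVec_mulVec, hK.mulVec_one,
    Matrix.one_mulVec]
  simp [dotProduct, Matrix.mulVec_diagonal, mul_sub]

lemma IsProbVec.mean_lt_one {N : ℕ} {p v : Fin N → ℝ} (hp : ∀ i, p i ∈ Set.Ioo (0 : ℝ) 1)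
    (hv : IsProbVec v) : ∑ i, v i * p i < 1 := by
  by_contra! h
  have h1 : ∑ i, v i * (1 - p i) ≤ 0 := by
    simp only [mul_sub, Finset.sum_sub_distrib, mul_one, hv.2]; linarith
  have h2 : ∀ i ∈ Finset.univ, 0 ≤ v i * (1 - p i) := fun i _ =>
    mul_nonneg (hv.1 i) (by linarith [(hp i).2])
  have h3 := (Finset.sum_eq_zero_iff_of_nonneg h2).1 (le_antisymm h1 (Finset.sum_nonneg h2))
  have h4 : ∀ i, v i = 0 := fun i =>
    (mul_eq_zero.1 (h3 i (Finset.mem_univ i))).resolve_right (by linarith [(hp i).2])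
  simpa [h4] using hv.2

lemma vecMul_one_sub_of_vecMul_eq {N : ℕ} {K : Matrix (Fin N) (Fin N) ℝ} {v : Fin N → ℝ}
    (hv : v ᵥ* K = v) (p : Fin N → ℝ) :
    v ᵥ* (1 - Matrix.diagonal p * K) = v ᵥ* (Matrix.diagonal (fun i => 1 - p i) * K) := by
  rw [one_sub_diagonal_mul, Matrix.vecMul_sub, Matrix.vecMul_sub, hv, Matrix.vecMul_one]

lemma IsStationaryDist.isProbVec_failure {N : ℕ} {K : Matrix (Fin N) (Fin N) ℝ}
    {μ p : Fin N → ℝ} (hK : IsStochastic K) (hμ : IsStationaryDist K μ)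
    (hp : ∀ i, p i ∈ Set.Ioo (0 : ℝ) 1) :
    IsProbVec ((1 / (1 - ∑ i, μ i * p i)) • (μ ᵥ* (1 - Matrix.diagonal p * K))) := by
  have h := hμ.1.mean_lt_one hp
  constructor
  · intro i
    rw [vecMul_one_sub_of_vecMul_eq hμ.2]
    refine mul_nonneg (by rw [one_div, inv_nonneg]; linarith) ?_
    refine vecMul_nonneg hμ.1.1 (fun j i => ?_) i
    rw [Matrix.diagonal_mul]
    exact mul_nonneg (by linarith [(hp j).2]) (hK.1 j i)
  · simp only [Pi.smul_apply, smul_eq_mul, ← Finset.mul_sum]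
    rw [hK.sum_vecMul_one_sub, hμ.1.2]
    exact one_div_mul_cancel (by linarith)

lemma IsStationaryDist.failure_vecMul {N : ℕ} {K : Matrix (Fin N) (Fin N) ℝ}
    {μ p : Fin N → ℝ} (hK : IsStochastic K) (hμ : IsStationaryDist K μ)
    (hp : ∀ i, p i ∈ Set.Ioo (0 : ℝ) 1) :
    ((1 / (1 - ∑ i, μ i * p i)) • (μ ᵥ* (1 - Matrix.diagonal p * K))) ᵥ*
        ((1 - Matrix.diagonal p * K)⁻¹ * (Matrix.diagonal (fun i => 1 - p i) * K)) =
      (1 / (1 - ∑ i, μ i * p i)) • (μ ᵥ* (1 - Matrix.diagonal p * K)) := by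
  rw [Matrix.smul_vecMul, Matrix.vecMul_vecMul, ← mul_assoc,
    Matrix.mul_nonsing_inv _ (hK.isUnit_det hp), one_mul,
    ← vecMul_one_sub_of_vecMul_eq hμ.2]

lemma HasUniqueStationaryDist.failure_unique {N : ℕ} {K : Matrix (Fin N) (Fin N) ℝ}
    {μ p : Fin N → ℝ} (hK : IsStochastic K) (hμ : HasUniqueStationaryDist K μ)
    (hp : ∀ i, p i ∈ Set.Ioo (0 : ℝ) 1) {v : Fin N → ℝ} (hv : IsProbVec v)
    (hvT : v ᵥ* ((1 - Matrix.diagonal p * K)⁻¹ * (Matrix.diagonal (fun i => 1 - p i) * K)) = v) :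
    v = (1 / (1 - ∑ i, μ i * p i)) • (μ ᵥ* (1 - Matrix.diagonal p * K)) := by
  set w := v ᵥ* (1 - Matrix.diagonal p * K)⁻¹ with hw
  have hwv : w ᵥ* (1 - Matrix.diagonal p * K) = v := by
    rw [hw, Matrix.vecMul_vecMul, Matrix.nonsing_inv_mul _ (hK.isUnit_det hp), Matrix.vecMul_one]
  have hwK : w ᵥ* K = w := by
    rw [← Matrix.vecMul_vecMul, ← hw, ← hwv, one_sub_diagonal_mul, Matrix.vecMul_sub,
      Matrix.vecMul_sub, Matrix.vecMul_one] at hvT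
    exact sub_left_injective hvT
  have hw0 : ∀ i, 0 ≤ w i := vecMul_nonneg hv.1 (hK.inv_nonneg hp)
  have hs0 : 0 ≤ ∑ i, w i := Finset.sum_nonneg fun i _ => hw0 i
  have hs : ∑ i, w i ≠ 0 := by
    intro h
    have h' : w = 0 := funext fun i =>
      (Finset.sum_eq_zero_iff_of_nonneg fun i _ => hw0 i).1 h i (Finset.mem_univ i)
    have := hv.2
    rw [← hwv, h', Matrix.zero_vecMul] at this
    simp at this
  have hwμ : (∑ i, w i)⁻¹ • w = μ := by
    refine hμ.2 _ ⟨⟨fun i => mul_nonneg (inv_nonneg.2 hs0) (hw0 i), ?_⟩, ?_⟩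
    · simp only [Pi.smul_apply, smul_eq_mul, ← Finset.mul_sum]
      exact inv_mul_cancel₀ hs
    · rw [Matrix.smul_vecMul, hwK]
  have hμw : w = (∑ i, w i) • μ := by rw [← hwμ, smul_inv_smul₀ hs]
  have h1 : (∑ i, w i) * (1 - ∑ i, μ i * p i) = 1 := by
    have := hv.2
    rw [← hwv, hμw, Matrix.smul_vecMul] at this
    simp only [Pi.smul_apply, smul_eq_mul, ← Finset.mul_sum] at this
    rwa [hK.sum_vecMul_one_sub, hμ.1.1.2] at this
  rw [← hwv, hμw, Matrix.smul_vecMul, eq_one_div_of_mul_eq_one_left h1]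

/-! ### Counting failures -/

/-- The number of failures among the first `n` trials. -/
def failCount (x : ℕ → Bool) (n : ℕ) : ℕ :=
  ((Finset.range n).filter fun j => x j = false).card

@[simp] lemma failCount_zero (x : ℕ → Bool) : failCount x 0 = 0 := by simp [failCount]

lemma failCount_succ (x : ℕ → Bool) (n : ℕ) :
    failCount x (n + 1) = failCount x n + if x n = false then 1 else 0 := by
  unfold failCount
  rw [Finset.range_add_one, Finset.filter_insert]
  split_ifs with h
  · rw [Finset.card_insert_of_notMem (by simp)]
  · rfl

lemma failCount_mono (x : ℕ → Bool) : Monotone (failCount x) :=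
  monotone_nat_of_le_succ fun n => by rw [failCount_succ]; exact Nat.le_add_right _ _

lemma failCount_le (x : ℕ → Bool) (n : ℕ) : failCount x n ≤ n :=
  (Finset.card_filter_le _ _).trans_eq (Finset.card_range n)

lemma failCount_congr {x y : ℕ → Bool} {n : ℕ} (h : ∀ j < n, x j = y j) :
    failCount x n = failCount y n := by
  unfold failCount
  congr 1
  exact Finset.filter_congr fun j hj => by rw [h j (Finset.mem_range.1 hj)]

/-- The trial following the `m`-th failure has index `S_m + m`. -/
lemma numSucc_add_of_fail {x : ℕ → Bool} {k m : ℕ} (hk : x k = false)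
    (hm : failCount x (k + 1) = m) : numSucc x m + m = k + 1 := by
  have hle : m ≤ k + 1 := hm ▸ failCount_le x (k + 1)
  have hmem : k + 1 - m ∈ {l | failCount x (l + m) = m} := by
    simpa [Nat.sub_add_cancel hle] using hm
  have hdef : numSucc x m = sInf {l | failCount x (l + m) = m} := rfl
  have h1 : numSucc x m ≤ k + 1 - m := hdef ▸ Nat.sInf_le hmem
  have h2 : failCount x (numSucc x m + m) = m := by
    have := Nat.sInf_mem ⟨_, hmem⟩
    rwa [← hdef] at this
  by_contra hne
  have h3 : failCount x (numSucc x m + m) ≤ failCount x k := failCount_mono x (by omega)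
  rw [failCount_succ, if_pos hk] at hm
  omega

@[simp] lemma numSucc_zero (x : ℕ → Bool) : numSucc x 0 = 0 := by simp [numSucc]

lemma exists_fail_of_eventually_ne {x : ℕ → Bool}
    (hx : ∀ m, ∀ᶠ n in atTop, failCount x n ≠ m) (m : ℕ) :
    ∃ k, x k = false ∧ failCount x (k + 1) = m + 1 := by
  have step : ∀ m, (∃ n, failCount x n = m) → ∃ k, x k = false ∧ failCount x (k + 1) = m + 1 := by
    rintro m ⟨n, hn⟩
    obtain ⟨n', hn', hne⟩ := ((eventually_ge_atTop n).and (hx m)).exists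
    have hex : ∃ d, failCount x (n + d) ≠ m := ⟨n' - n, by rwa [Nat.add_sub_cancel' hn']⟩
    obtain ⟨k, hk⟩ : ∃ k, Nat.find hex = k + 1 := by
      refine Nat.exists_eq_succ_of_ne_zero fun h => ?_
      have := Nat.find_spec hex
      rw [h] at this
      exact this hn
    have h1 := Nat.find_spec hex
    have h2 := Nat.find_min hex (m := k) (by omega)
    rw [hk, ← add_assoc, failCount_succ] at h1
    rw [not_not] at h2
    refine ⟨n + k, ?_, ?_⟩
    · by_contra h
      simp [h, h2] at h1
    · have h : x (n + k) = false := by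
        by_contra h
        simp [h, h2] at h1
      rw [failCount_succ, if_pos h, h2]
  induction m with
  | zero => exact step 0 ⟨0, failCount_zero x⟩
  | succ m ih => exact step (m + 1) (ih.imp' _ fun _ h => h.2)

/-- The index of a failure is determined by the number of failures up to it. -/
lemma fail_index_unique {x : ℕ → Bool} {k l : ℕ} (hk : x k = false) (hl : x l = false)
    (h : failCount x k = failCount x l) : k = l := by
  have h1 := numSucc_add_of_fail hk rfl
  have h2 := numSucc_add_of_fail hl rfl
  rw [failCount_succ, if_pos hk, h] at h1
  rw [failCount_succ, if_pos hl] at h2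
  omega

/-! ### Histories -/

section History

variable {N : ℕ} {Ω : Type*} {Rc : ℕ → Ω → Fin N} {ξ : ℕ → Ω → Bool}

/-- The states up to time `n` and the trials before time `n`. -/
def history (Rc : ℕ → Ω → Fin N) (ξ : ℕ → Ω → Bool) (n : ℕ) (ω : Ω) :
    (Fin (n + 1) → Fin N) × (Fin n → Bool) :=
  (fun j => Rc j ω, fun j => ξ j ω)

lemma history_eq_iff {n : ℕ} {ω ω' : Ω} : history Rc ξ n ω = history Rc ξ n ω' ↔
    (∀ j ≤ n, Rc j ω = Rc j ω') ∧ ∀ j < n, ξ j ω = ξ j ω' := by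
  simp only [history, Prod.mk.injEq, funext_iff, Fin.forall_iff, Nat.lt_succ_iff]

/-- `A` is determined by the states up to time `n` and the trials before time `n`. -/
def IsHistoryEvent (Rc : ℕ → Ω → Fin N) (ξ : ℕ → Ω → Bool) (n : ℕ) (A : Set Ω) : Prop :=
  ∀ ω ω', history Rc ξ n ω = history Rc ξ n ω' → ω ∈ A → ω' ∈ A

/-- The `m`-th failure has occurred by time `n` but the next one has not, the chain is in state
`x` at time `n`, and the state after the `j`-th failure lies in `C j` for all `j ≤ m`. -/
def failEvent (Rc : ℕ → Ω → Fin N) (ξ : ℕ → Ω → Bool) (C : ℕ → Set (Fin N)) (n m : ℕ)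
    (x : Fin N) : Set Ω :=
  {ω | Rc 0 ω ∈ C 0 ∧
    (∀ k < n, ξ k ω = false → Rc (k + 1) ω ∈ C (failCount (fun j => ξ j ω) (k + 1))) ∧
    failCount (fun j => ξ j ω) n = m ∧ Rc n ω = x}

lemma isHistoryEvent_failEvent (C : ℕ → Set (Fin N)) (n m : ℕ) (x : Fin N) :
    IsHistoryEvent Rc ξ n (failEvent Rc ξ C n m x) := by
  rintro ω ω' he ⟨h0, h1, h2, h3⟩
  rw [history_eq_iff] at he
  obtain ⟨hR, hξ⟩ := he
  refine ⟨?_, fun k hk hf => ?_, ?_, ?_⟩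
  · rwa [← hR 0 (Nat.zero_le n)]
  · rw [← hR (k + 1) hk, ← failCount_congr (x := fun j => ξ j ω) fun j hj => hξ j (by omega)]
    exact h1 k hk (by rw [hξ k hk, hf])
  · rw [← failCount_congr (x := fun j => ξ j ω) fun j hj => hξ j hj, h2]
  · rw [← hR n le_rfl, h3]

lemma failEvent_zero_succ (C : ℕ → Set (Fin N)) (m : ℕ) (x : Fin N) :
    failEvent Rc ξ C 0 (m + 1) x = ∅ := by
  refine eq_empty_of_forall_notMem ?_
  rintro ω ⟨-, -, h, -⟩
  simp at h

lemma failEvent_succ_inter_true (C : ℕ → Set (Fin N)) (n m : ℕ) (x y : Fin N) :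
    failEvent Rc ξ C (n + 1) m y ∩ (fun ω => (ξ n ω, Rc n ω)) ⁻¹' {(true, x)} =
      failEvent Rc ξ C n m x ∩ {ω | ξ n ω = true ∧ Rc (n + 1) ω = y} := by
  ext ω
  simp only [failEvent, mem_inter_iff, mem_ofPred_eq, mem_preimage, mem_singleton_iff,
    Prod.mk.injEq, failCount_succ _ n, Nat.forall_lt_succ_right]
  constructor
  · rintro ⟨⟨h0, h1, h2, h3⟩, h4, h5⟩
    exact ⟨⟨h0, h1.1, by simpa [h4] using h2, h5⟩, h4, h3⟩
  · rintro ⟨⟨h0, h1, h2, h3⟩, h4, h5⟩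
    exact ⟨⟨h0, ⟨h1, by simp [h4]⟩, by simpa [h4] using h2, h5⟩, h4, h3⟩

lemma failEvent_succ_inter_false (C : ℕ → Set (Fin N)) (n m : ℕ) (x y : Fin N) :
    failEvent Rc ξ C (n + 1) (m + 1) y ∩ (fun ω => (ξ n ω, Rc n ω)) ⁻¹' {(false, x)} =
      if y ∈ C (m + 1) then
        failEvent Rc ξ C n m x ∩ {ω | ξ n ω = false ∧ Rc (n + 1) ω = y} else ∅ := by
  ext ω
  simp only [failEvent, mem_inter_iff, mem_ofPred_eq, mem_preimage, mem_singleton_iff,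
    Prod.mk.injEq, failCount_succ _ n, Nat.forall_lt_succ_right]
  constructor
  · rintro ⟨⟨h0, h1, h2, h3⟩, h4, h5⟩
    have h6 := h1.2 h4
    rw [h2, h3] at h6
    rw [if_pos h6]
    exact ⟨⟨h0, h1.1, by simpa [h4] using h2, h5⟩, h4, h3⟩
  · intro H
    split_ifs at H with hy
    · obtain ⟨⟨h0, h1, h2, h3⟩, h4, h5⟩ := H
      exact ⟨⟨h0, ⟨h1, fun _ => by simpa [h4, h2, h5] using hy⟩, by simpa [h4] using h2, h5⟩,
        h4, h3⟩
    · exact H.elim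

lemma failEvent_succ_zero_inter_false (C : ℕ → Set (Fin N)) (n : ℕ) (x y : Fin N) :
    failEvent Rc ξ C (n + 1) 0 y ∩ (fun ω => (ξ n ω, Rc n ω)) ⁻¹' {(false, x)} = ∅ := by
  refine eq_empty_of_forall_notMem ?_
  rintro ω ⟨⟨-, -, h, -⟩, h'⟩
  rw [failCount_succ, if_pos (Prod.ext_iff.1 h').1] at h
  omega

/-- The states after failures up to the `(m + 1)`-st one, when that failure is trial `k`. -/
lemma forall_Ichain_eq_iff {ω : Ω} {f : ℕ → Fin N} {k m : ℕ}
    (hω : ∀ m, ∃ k, ξ k ω = false ∧ failCount (fun j => ξ j ω) (k + 1) = m + 1)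
    (hk : ξ k ω = false) (hm : failCount (fun j => ξ j ω) (k + 1) = m + 1) :
    (∀ j ≤ m + 1, Ichain Rc ξ ω j = f j) ↔
      ω ∈ failEvent Rc ξ (fun j => {f j}) (k + 1) (m + 1) (f (m + 1)) := by
  have hI : ∀ {l j}, ξ l ω = false → failCount (fun j => ξ j ω) (l + 1) = j →
      Ichain Rc ξ ω j = Rc (l + 1) ω := fun hl hj => by
    rw [Ichain, numSucc_add_of_fail (x := fun j => ξ j ω) hl hj]
  have hI0 : Ichain Rc ξ ω 0 = Rc 0 ω := by simp [Ichain]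
  constructor
  · intro H
    refine ⟨hI0 ▸ H 0 (Nat.zero_le _), fun l hl hlf => ?_, hm, ?_⟩
    · rw [← hI hlf rfl]
      exact H _ (hm ▸ failCount_mono _ hl)
    · rw [← hI hk hm]
      exact H _ le_rfl
  · rintro ⟨h0, h1, -, -⟩ j hj
    rcases j with _ | j
    · rw [hI0]
      exact h0
    · obtain ⟨l, hl, hlj⟩ := hω j
      have hlk : l < k + 1 := by
        by_contra! hlt
        have h2 := failCount_mono (fun j => ξ j ω) hlt
        rw [failCount_succ _ l, if_pos hl] at hlj
        omega
      have h2 := h1 l hlk hl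
      rw [hlj] at h2
      rw [hI hl hlj]
      exact h2

end History

/-! ### The Markov property of the environment together with the trials -/

lemma measureReal_eq_sum_inter_preimage {Ω ι : Type*} [MeasurableSpace Ω] (P : Measure Ω)
    [IsFiniteMeasure P] [Fintype ι] [MeasurableSpace ι] [MeasurableSingletonClass ι]
    {Z : Ω → ι} (hZ : Measurable Z) (A : Set Ω) :
    P.real A = ∑ i, P.real (A ∩ Z ⁻¹' {i}) := by
  have h := sum_measureReal_preimage_singleton (μ := P.restrict A) Finset.univ (f := Z)
    (fun i _ => hZ (measurableSet_singleton i))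
  simp only [Finset.coe_univ, preimage_univ, measureReal_restrict_apply_univ] at h
  rw [← h]
  exact Finset.sum_congr rfl fun i _ => by
    rw [measureReal_restrict_apply (hZ (measurableSet_singleton i)), inter_comm]

/-- Probability of the outcome `c` of a trial with success probability `q`. -/
def trialProb (q : ℝ) (c : Bool) : ℝ := if c then q else 1 - q

section CookieSite

variable {N : ℕ} {Ω : Type*} [MeasurableSpace Ω] {P : Measure Ω}
  {K : Matrix (Fin N) (Fin N) ℝ} {p η : Fin N → ℝ} {Rc : ℕ → Ω → Fin N} {ξ : ℕ → Ω → Bool}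

lemma IsCookieSite.measurable_history (h : IsCookieSite P K p η Rc ξ) (n : ℕ) :
    Measurable (history Rc ξ n) :=
  Measurable.prodMk (f := fun ω (j : Fin (n + 1)) => Rc j ω) (g := fun ω (j : Fin n) => ξ j ω)
    (measurable_pi_lambda _ fun j => h.1 j) (measurable_pi_lambda _ fun j => h.2.1 j)

lemma IsCookieSite.measurableSet (h : IsCookieSite P K p η Rc ξ) {n : ℕ} {A : Set Ω}
    (hA : IsHistoryEvent Rc ξ n A) : MeasurableSet A := by
  have : A = history Rc ξ n ⁻¹' (history Rc ξ n '' A) := by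
    refine (subset_preimage_image _ _).antisymm ?_
    rintro ω ⟨ω', hω', he⟩
    exact hA _ _ he hω'
  rw [this]
  exact h.measurable_history n (Set.toFinite _).measurableSet

variable [IsProbabilityMeasure P]

/-- The law of the states up to time `n` and the trials before time `n`. -/
lemma IsCookieSite.measureReal_cylinder (h : IsCookieSite P K p η Rc ξ) (n : ℕ)
    (f : ℕ → Fin N) (b : ℕ → Bool) :
    P.real {ω | (∀ j ≤ n, Rc j ω = f j) ∧ ∀ j < n, ξ j ω = b j} =
      η (f 0) * (∏ j ∈ Finset.range n, K (f j) (f (j + 1))) *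
        ∏ j ∈ Finset.range n, trialProb (p (f j)) (b j) := by
  have key : ∀ c, P.real ({ω | (∀ j ≤ n, Rc j ω = f j) ∧ ∀ j < n, ξ j ω = b j} ∩ ξ n ⁻¹' {c}) =
      η (f 0) * (∏ j ∈ Finset.range n, K (f j) (f (j + 1))) *
        ((∏ j ∈ Finset.range n, trialProb (p (f j)) (b j)) * trialProb (p (f n)) c) := by
    intro c
    have h1 := h.2.2 n f (Function.update b n c)
    rw [Finset.prod_range_succ] at h1
    have h2 : ∀ j ∈ Finset.range n, (if Function.update b n c j then p (f j) else 1 - p (f j)) =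
        trialProb (p (f j)) (b j) := by
      intro j hj
      rw [Function.update_of_ne (Finset.mem_range.1 hj).ne]
      rfl
    rw [Finset.prod_congr rfl h2, Function.update_self] at h1
    refine Eq.trans ?_ h1
    refine congrArg P.real (Set.ext fun ω => ?_)
    simp only [mem_inter_iff, mem_ofPred_eq, mem_preimage, mem_singleton_iff]
    constructor
    · rintro ⟨⟨hR, hb⟩, hc⟩ j hj
      refine ⟨hR j hj, ?_⟩
      rcases hj.lt_or_eq with hj | rfl
      · rw [Function.update_of_ne hj.ne, hb j hj]
      · rw [Function.update_self, hc]
    · intro H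
      refine ⟨⟨fun j hj => (H j hj).1, fun j hj => ?_⟩, ?_⟩
      · rw [(H j hj.le).2, Function.update_of_ne hj.ne]
      · rw [(H n le_rfl).2, Function.update_self]
  rw [measureReal_eq_sum_inter_preimage P (h.2.1 n), Fintype.sum_bool, key, key]
  simp only [trialProb]
  simp
  ring

/-- The Markov property at time `n`. -/
lemma IsCookieSite.measureReal_inter_step (h : IsCookieSite P K p η Rc ξ) {n : ℕ} {A : Set Ω}
    (hA : IsHistoryEvent Rc ξ n A) {x : Fin N} (hx : ∀ ω ∈ A, Rc n ω = x) (c : Bool)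
    (y : Fin N) :
    P.real (A ∩ {ω | ξ n ω = c ∧ Rc (n + 1) ω = y}) =
      P.real A * (trialProb (p x) c * K x y) := by
  rw [measureReal_eq_sum_inter_preimage P (h.measurable_history n),
    measureReal_eq_sum_inter_preimage P (h.measurable_history n) A, Finset.sum_mul]
  refine Finset.sum_congr rfl fun g _ => ?_
  rcases (A ∩ history Rc ξ n ⁻¹' {g}).eq_empty_or_nonempty with he | ⟨ω₀, hω₀, hg⟩
  · rw [inter_right_comm, he]
    simp
  · obtain rfl : history Rc ξ n ω₀ = g := hg
    have h1 : A ∩ history Rc ξ n ⁻¹' {history Rc ξ n ω₀} =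
        {ω | (∀ j ≤ n, Rc j ω = Rc j ω₀) ∧ ∀ j < n, ξ j ω = ξ j ω₀} := by
      ext ω
      simp only [mem_inter_iff, mem_preimage, mem_singleton_iff, history_eq_iff, mem_ofPred_eq,
        and_iff_right_iff_imp]
      exact fun H => hA _ _ (history_eq_iff.2 H).symm hω₀
    let f : ℕ → Fin N := Function.update (fun j => Rc j ω₀) (n + 1) y
    let b : ℕ → Bool := Function.update (fun j => ξ j ω₀) n c
    have hf : ∀ j ≤ n, f j = Rc j ω₀ := fun j hj => Function.update_of_ne (by omega) _ _
    have hf' : f (n + 1) = y := Function.update_self _ _ _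
    have hb : ∀ j < n, b j = ξ j ω₀ := fun j hj => Function.update_of_ne hj.ne _ _
    have hb' : b n = c := Function.update_self _ _ _
    have h2 : {ω | (∀ j ≤ n, Rc j ω = Rc j ω₀) ∧ ∀ j < n, ξ j ω = ξ j ω₀} ∩
        {ω | ξ n ω = c ∧ Rc (n + 1) ω = y} =
        {ω | (∀ j ≤ n + 1, Rc j ω = f j) ∧ ∀ j < n + 1, ξ j ω = b j} := by
      ext ω
      simp only [mem_inter_iff, mem_ofPred_eq]
      constructor
      · rintro ⟨⟨hR, hξ⟩, hc, hy⟩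
        refine ⟨fun j hj => ?_, fun j hj => ?_⟩
        · rcases hj.lt_or_eq with hj | rfl
          · rw [hf j (by omega), hR j (by omega)]
          · rw [hf', hy]
        · rcases (Nat.lt_succ_iff.1 hj).lt_or_eq with hj | rfl
          · rw [hb j hj, hξ j hj]
          · rw [hb', hc]
      · rintro ⟨hR, hξ⟩
        refine ⟨⟨fun j hj => ?_, fun j hj => ?_⟩, ?_, ?_⟩
        · rw [hR j (by omega), hf j hj]
        · rw [hξ j (by omega), hb j hj]
        · rw [hξ n (by omega), hb']
        · rw [hR (n + 1) le_rfl, hf']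
    have hprodK : ∏ j ∈ Finset.range n, K (f j) (f (j + 1)) =
        ∏ j ∈ Finset.range n, K (Rc j ω₀) (Rc (j + 1) ω₀) :=
      Finset.prod_congr rfl fun j hj => by
        rw [hf j (Finset.mem_range.1 hj).le, hf (j + 1) (Finset.mem_range.1 hj)]
    have hprodp : ∏ j ∈ Finset.range n, trialProb (p (f j)) (b j) =
        ∏ j ∈ Finset.range n, trialProb (p (Rc j ω₀)) (ξ j ω₀) :=
      Finset.prod_congr rfl fun j hj => by
        rw [hf j (Finset.mem_range.1 hj).le, hb j (Finset.mem_range.1 hj)]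
    rw [inter_right_comm, h1, h2, h.measureReal_cylinder, h.measureReal_cylinder,
      Finset.prod_range_succ, Finset.prod_range_succ, hf 0 (Nat.zero_le n), hf n le_rfl, hf', hb',
      hx ω₀ hω₀,
      hprodK, hprodp]
    ring

lemma measureReal_failEvent_zero_zero (h : IsCookieSite P K p η Rc ξ) (C : ℕ → Set (Fin N))
    (x : Fin N) :
    P.real (failEvent Rc ξ C 0 0 x) = if x ∈ C 0 then η x else 0 := by
  split_ifs with hx
  · have h1 := h.measureReal_cylinder 0 (fun _ => x) (fun _ => true)
    simp only [Finset.range_zero, Finset.prod_empty, mul_one] at h1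
    rw [← h1]
    refine congrArg P.real (Set.ext fun ω => ?_)
    simp only [failEvent, mem_ofPred_eq, failCount_zero]
    constructor
    · rintro ⟨-, -, -, h⟩
      simpa using h
    · rintro ⟨h, -⟩
      simpa [h 0 le_rfl] using hx
  · have : failEvent Rc ξ C 0 0 x = ∅ := by
      refine eq_empty_of_forall_notMem ?_
      rintro ω ⟨h0, -, -, h3⟩
      exact hx (h3 ▸ h0)
    simp [this]

/-- The recursion for the probabilities of `failEvent` when no failure has occurred. -/
lemma measureReal_failEvent_succ_zero (h : IsCookieSite P K p η Rc ξ) (C : ℕ → Set (Fin N))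
    (n : ℕ) :
    (fun y => P.real (failEvent Rc ξ C (n + 1) 0 y)) =
      (fun x => P.real (failEvent Rc ξ C n 0 x)) ᵥ* (Matrix.diagonal p * K) := by
  ext y
  rw [measureReal_eq_sum_inter_preimage P ((h.2.1 n).prodMk (h.1 n)), Fintype.sum_prod_type,
    Fintype.sum_bool]
  simp_rw [failEvent_succ_inter_true, failEvent_succ_zero_inter_false]
  simp_rw [h.measureReal_inter_step (isHistoryEvent_failEvent C n _ _) (fun ω hω => hω.2.2.2)]
  simp [Matrix.vecMul, dotProduct, Matrix.diagonal_mul, trialProb]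

/-- The recursion for the probabilities of `failEvent`. -/
lemma measureReal_failEvent_succ_succ (h : IsCookieSite P K p η Rc ξ) (C : ℕ → Set (Fin N))
    (n m : ℕ) :
    (fun y => P.real (failEvent Rc ξ C (n + 1) (m + 1) y)) =
      (fun x => P.real (failEvent Rc ξ C n (m + 1) x)) ᵥ* (Matrix.diagonal p * K) +
      (C (m + 1)).indicator ((fun x => P.real (failEvent Rc ξ C n m x)) ᵥ*
        (Matrix.diagonal (fun i => 1 - p i) * K)) := by
  ext y
  rw [measureReal_eq_sum_inter_preimage P ((h.2.1 n).prodMk (h.1 n)), Fintype.sum_prod_type,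
    Fintype.sum_bool]
  simp_rw [failEvent_succ_inter_true, failEvent_succ_inter_false]
  by_cases hy : y ∈ C (m + 1)
  · simp_rw [if_pos hy,
      h.measureReal_inter_step (isHistoryEvent_failEvent C n _ _) (fun ω hω => hω.2.2.2)]
    simp [Matrix.vecMul, dotProduct, Matrix.diagonal_mul, trialProb, hy]
  · simp_rw [if_neg hy,
      h.measureReal_inter_step (isHistoryEvent_failEvent C n _ _) (fun ω hω => hω.2.2.2)]
    simp [Matrix.vecMul, dotProduct, Matrix.diagonal_mul, trialProb, hy]

/-- Summing a recursion `a (n + 1) = a n D_p K + b n`. -/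
lemma IsStochastic.hasSum_of_recursion (hK : IsStochastic K)
    (hp : ∀ i, p i ∈ Set.Ioo (0 : ℝ) 1) {a b : ℕ → Fin N → ℝ} {B : Fin N → ℝ}
    (ha : ∀ n i, 0 ≤ a n i) (hb : ∀ n i, 0 ≤ b n i)
    (hrec : ∀ n, a (n + 1) = a n ᵥ* (Matrix.diagonal p * K) + b n) (hB : HasSum b B) :
    HasSum a ((a 0 + B) ᵥ* (1 - Matrix.diagonal p * K)⁻¹) := by
  set G := (1 - Matrix.diagonal p * K)⁻¹ with hG
  have hpart : ∀ n, (∑ k ∈ Finset.range n, a k) ᵥ* (1 - Matrix.diagonal p * K) =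
      a 0 + ∑ k ∈ Finset.range n, b k - a n := by
    intro n
    induction n with
    | zero => simp
    | succ n ih =>
      rw [Finset.sum_range_succ, Matrix.add_vecMul, ih, Finset.sum_range_succ, hrec,
        Matrix.vecMul_sub, Matrix.vecMul_one]
      abel
  have hpart' : ∀ n, ∑ k ∈ Finset.range n, a k =
      (a 0 + ∑ k ∈ Finset.range n, b k - a n) ᵥ* G := by
    intro n
    rw [← hpart, Matrix.vecMul_vecMul, hG, Matrix.mul_nonsing_inv _ (hK.isUnit_det hp),
      Matrix.vecMul_one]
  have hB' : ∀ i, HasSum (fun n => b n i) (B i) := Pi.hasSum.1 hB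
  have hbound : ∀ i n, ∑ k ∈ Finset.range n, a k i ≤ ((a 0 + B) ᵥ* G) i := by
    intro i n
    rw [← Finset.sum_apply, hpart']
    refine vecMul_le_vecMul (hK.inv_nonneg hp) (fun j => ?_) i
    have h1 := sum_le_hasSum (Finset.range n) (fun k _ => hb k j) (hB' j)
    have h2 := ha n j
    simp only [Pi.sub_apply, Pi.add_apply, Finset.sum_apply]
    linarith
  have hsum : Summable a :=
    Pi.summable.2 fun i => summable_of_sum_range_le (fun n => ha n i) (hbound i)
  have hlim := hsum.tendsto_atTop_zero
  have hcont : Continuous fun v : Fin N → ℝ => v ᵥ* G := by fun_prop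
  have h := (hcont.tendsto _).comp ((hB.tendsto_sum_nat.const_add (a 0)).sub hlim)
  rw [sub_zero] at h
  have hlim' : Tendsto (fun n => ∑ k ∈ Finset.range n, a k) atTop (nhds ((a 0 + B) ᵥ* G)) :=
    h.congr fun n => (hpart' n).symm
  rw [← tendsto_nhds_unique hsum.hasSum.tendsto_sum_nat hlim']
  exact hsum.hasSum

/-- The expected time spent in each state between the `m`-th and the next failure, on the event
that the state after the `j`-th failure lies in `C j` for all `j ≤ m`. -/
def occupation (K : Matrix (Fin N) (Fin N) ℝ) (p η : Fin N → ℝ) (C : ℕ → Set (Fin N)) :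
    ℕ → Fin N → ℝ
  | 0 => (C 0).indicator η ᵥ* (1 - Matrix.diagonal p * K)⁻¹
  | m + 1 => (C (m + 1)).indicator
      (occupation K p η C m ᵥ* (Matrix.diagonal (fun i => 1 - p i) * K)) ᵥ*
        (1 - Matrix.diagonal p * K)⁻¹

lemma hasSum_measureReal_failEvent (h : IsCookieSite P K p η Rc ξ) (hK : IsStochastic K)
    (hp : ∀ i, p i ∈ Set.Ioo (0 : ℝ) 1) (C : ℕ → Set (Fin N)) (m : ℕ) :
    HasSum (fun n x => P.real (failEvent Rc ξ C n m x)) (occupation K p η C m) := by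
  induction m with
  | zero =>
    have h1 := hK.hasSum_of_recursion hp (b := fun _ => 0) (B := 0)
      (a := fun n x => P.real (failEvent Rc ξ C n 0 x)) (fun _ _ => measureReal_nonneg)
      (fun _ _ => le_rfl)
      (fun n => by rw [measureReal_failEvent_succ_zero h C n, add_zero]) hasSum_zero
    have h2 : (fun x => P.real (failEvent Rc ξ C 0 0 x)) = (C 0).indicator η :=
      funext fun x => by rw [measureReal_failEvent_zero_zero h, indicator_apply]
    rw [add_zero, h2] at h1
    exact h1
  | succ m ih =>
    have hB : HasSum (fun n => (C (m + 1)).indicator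
        ((fun x => P.real (failEvent Rc ξ C n m x)) ᵥ*
          (Matrix.diagonal (fun i => 1 - p i) * K)))
        ((C (m + 1)).indicator
          (occupation K p η C m ᵥ* (Matrix.diagonal (fun i => 1 - p i) * K))) := by
      refine Pi.hasSum.2 fun y => ?_
      by_cases hy : y ∈ C (m + 1)
      · simp only [indicator_of_mem hy]
        exact ih.vecMul_apply _ y
      · simp only [indicator_of_notMem hy]
        exact hasSum_zero
    have h1 := hK.hasSum_of_recursion hp
      (a := fun n x => P.real (failEvent Rc ξ C n (m + 1) x)) (fun _ _ => measureReal_nonneg)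
      (fun n y => indicator_nonneg (fun y _ => vecMul_nonneg (fun _ => measureReal_nonneg)
        (fun i j => by
          rw [Matrix.diagonal_mul]
          exact mul_nonneg (by linarith [(hp i).2]) (hK.1 i j)) y) y)
      (measureReal_failEvent_succ_succ h C · m) hB
    have h2 : (fun x => P.real (failEvent Rc ξ C 0 (m + 1) x)) = 0 :=
      funext fun x => by rw [failEvent_zero_succ, measureReal_empty]; rfl
    rw [h2, zero_add] at h1
    exact h1

/-- Almost surely there are infinitely many failures. -/
lemma ae_exists_fail (h : IsCookieSite P K p η Rc ξ) (hK : IsStochastic K)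
    (hp : ∀ i, p i ∈ Set.Ioo (0 : ℝ) 1) :
    ∀ᵐ ω ∂P, ∀ m, ∃ k, ξ k ω = false ∧ failCount (fun j => ξ j ω) (k + 1) = m + 1 := by
  have h1 : ∀ᵐ ω ∂P, ∀ m x, ∀ᶠ n in atTop, ω ∉ failEvent Rc ξ (fun _ => univ) n m x := by
    rw [ae_all_iff]; intro m
    rw [ae_all_iff]; intro x
    refine ae_eventually_notMem ?_
    have hs := (Pi.hasSum.1 (hasSum_measureReal_failEvent h hK hp (fun _ => univ) m) x).summable
    exact (tsum_congr fun n => ofReal_measureReal).symm.trans_ne hs.tsum_ofReal_ne_top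
  filter_upwards [h1] with ω hω
  refine exists_fail_of_eventually_ne fun m => ?_
  filter_upwards [eventually_all.2 (hω m)] with n hn hm
  exact hn (Rc n ω) ⟨trivial, fun _ _ _ => trivial, hm, rfl⟩

lemma occupation_singleton (f : ℕ → Fin N) (m : ℕ) :
    occupation K p η (fun j => {f j}) m =
      (η (f 0) * ∏ j ∈ Finset.range m,
        ((1 - Matrix.diagonal p * K)⁻¹ * (Matrix.diagonal (fun i => 1 - p i) * K))
          (f j) (f (j + 1))) • (1 - Matrix.diagonal p * K)⁻¹ (f m) := by
  have hind : ∀ (v : Fin N → ℝ) i, ({i} : Set (Fin N)).indicator v = Pi.single i (v i) :=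
    fun v i => by
      ext j
      rcases eq_or_ne j i with rfl | hj <;> simp [*]
  induction m with
  | zero =>
    rw [occupation, hind, Matrix.single_vecMul]
    simp
    rfl
  | succ m ih =>
    rw [occupation, ih, hind, Matrix.single_vecMul, Finset.prod_range_succ, ← mul_assoc (η (f 0)),
      Matrix.smul_vecMul]
    rfl

/-- `I` is a Markov chain with transition matrix `(I − D_p K)⁻¹ D_{1-p} K`. -/
lemma measureReal_forall_Ichain_eq (h : IsCookieSite P K p η Rc ξ) (hK : IsStochastic K)
    (hp : ∀ i, p i ∈ Set.Ioo (0 : ℝ) 1) (m : ℕ) (f : ℕ → Fin N) :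
    P.real {ω | ∀ j ≤ m, Ichain Rc ξ ω j = f j} =
      η (f 0) * ∏ j ∈ Finset.range m,
        ((1 - Matrix.diagonal p * K)⁻¹ * (Matrix.diagonal (fun i => 1 - p i) * K))
          (f j) (f (j + 1)) := by
  rcases m with _ | m
  · have h1 := h.measureReal_cylinder 0 f (fun _ => true)
    simpa [Ichain] using h1
  · set B : ℕ → Set Ω := fun n =>
      failEvent Rc ξ (fun j => {f j}) (n + 1) (m + 1) (f (m + 1)) ∩ ξ n ⁻¹' {false} with hB
    have hmeas : ∀ n, MeasurableSet (B n) := fun n =>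
      (h.measurableSet (isHistoryEvent_failEvent _ _ _ _)).inter
        (h.2.1 n (measurableSet_singleton false))
    have hdisj : Pairwise (Function.onFun Disjoint B) := by
      intro k l hkl
      refine Set.disjoint_left.2 ?_
      rintro ω ⟨⟨-, -, hk, -⟩, hkf⟩ ⟨⟨-, -, hl, -⟩, hlf⟩
      refine hkl (fail_index_unique (x := fun j => ξ j ω) hkf hlf ?_)
      rw [failCount_succ, if_pos (by exact hkf)] at hk
      rw [failCount_succ, if_pos (by exact hlf)] at hl
      omega
    have hae : {ω | ∀ j ≤ m + 1, Ichain Rc ξ ω j = f j} =ᵐ[P] ⋃ n, B n := by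
      filter_upwards [ae_exists_fail h hK hp] with ω hω
      obtain ⟨k, hk, hm⟩ := hω m
      refine propext ⟨fun H => ?_, fun H => ?_⟩
      · exact mem_iUnion.2 ⟨k, (forall_Ichain_eq_iff hω hk hm).1 H, hk⟩
      · obtain ⟨l, hl, hlf⟩ := mem_iUnion.1 H
        exact (forall_Ichain_eq_iff hω hlf hl.2.2.1).2 hl
    have hreal : ∀ n, P.real (B n) =
        ((fun x => P.real (failEvent Rc ξ (fun j => {f j}) n m x)) ᵥ*
          (Matrix.diagonal (fun i => 1 - p i) * K)) (f (m + 1)) := by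
      intro n
      rw [measureReal_eq_sum_inter_preimage P (h.1 n)]
      refine Finset.sum_congr rfl fun x _ => ?_
      have h1 : B n ∩ Rc n ⁻¹' {x} =
          failEvent Rc ξ (fun j => {f j}) (n + 1) (m + 1) (f (m + 1)) ∩
            (fun ω => (ξ n ω, Rc n ω)) ⁻¹' {(false, x)} := by
        ext ω
        simp [hB, and_assoc]
      rw [h1, failEvent_succ_inter_false, if_pos (mem_singleton _),
        h.measureReal_inter_step (isHistoryEvent_failEvent _ n _ _) (fun ω hω => hω.2.2.2)]
      simp [Matrix.diagonal_mul, trialProb]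
    have hsum : HasSum (fun n => P.real (B n))
        ((occupation K p η (fun j => {f j}) m ᵥ* (Matrix.diagonal (fun i => 1 - p i) * K))
          (f (m + 1))) := by
      simp_rw [hreal]
      exact (hasSum_measureReal_failEvent h hK hp (fun j => {f j}) m).vecMul_apply _ _
    rw [measureReal_congr hae, measureReal_def, measure_iUnion hdisj hmeas,
      ENNReal.tsum_toReal_eq fun n => measure_ne_top _ _]
    simp_rw [← measureReal_def]
    rw [hsum.tsum_eq, occupation_singleton, Finset.prod_range_succ, ← mul_assoc (η (f 0)),
      Matrix.smul_vecMul]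
    rfl

/-- The expected number of successes before the first failure. -/
lemma integral_numSucc_one (h : IsCookieSite P K p η Rc ξ) (hK : IsStochastic K)
    (hp : ∀ i, p i ∈ Set.Ioo (0 : ℝ) 1) :
    ∫ ω, (numSucc (fun j => ξ j ω) 1 : ℝ) ∂P = η ⬝ᵥ ((1 - Matrix.diagonal p * K)⁻¹ *ᵥ p) := by
  set A : ℕ → Set Ω := fun n => {ω | failCount (fun j => ξ j ω) (n + 1) = 0} with hA
  have hAm : ∀ n, MeasurableSet (A n) := by
    refine fun n => h.measurableSet (n := n + 1) fun ω ω' he hω => ?_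
    rw [history_eq_iff] at he
    exact (failCount_congr he.2).symm.trans hω
  have hAreal : ∀ n, P.real (A n) =
      ∑ y, P.real (failEvent Rc ξ (fun _ => univ) (n + 1) 0 y) := by
    intro n
    rw [measureReal_eq_sum_inter_preimage P (h.1 (n + 1))]
    refine Finset.sum_congr rfl fun y _ => congrArg P.real (Set.ext fun ω => ?_)
    simp [hA, failEvent]
  have hsum : HasSum (fun n => P.real (A n)) (η ⬝ᵥ ((1 - Matrix.diagonal p * K)⁻¹ *ᵥ p)) := by
    have h1 : HasSum (fun n => (fun x => P.real (failEvent Rc ξ (fun _ => univ) n 0 x)) ⬝ᵥ p)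
        (occupation K p η (fun _ => univ) 0 ⬝ᵥ p) := hasSum_sum fun x _ =>
      (Pi.hasSum.1 (hasSum_measureReal_failEvent h hK hp (fun _ => univ) 0) x).mul_right _
    rw [occupation, indicator_univ, ← Matrix.dotProduct_mulVec] at h1
    convert h1 using 2 with n
    have h2 : (Matrix.diagonal p * K) *ᵥ 1 = p := by
      rw [← Matrix.mulVec_mulVec, hK.mulVec_one]
      ext i
      simp [Matrix.mulVec_diagonal]
    rw [hAreal]
    conv_rhs => rw [← h2]
    rw [Matrix.dotProduct_mulVec, ← measureReal_failEvent_succ_zero h]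
    simp [dotProduct]
  have hint : ∀ n, ∫ ω, (A n).indicator (fun _ => (1 : ℝ)) ω ∂P = P.real (A n) := fun n => by
    rw [integral_indicator_const _ (hAm n), smul_eq_mul, mul_one]
  have hS := hasSum_integral_of_summable_integral_norm (μ := P)
    (F := fun n => (A n).indicator fun _ => (1 : ℝ))
    (fun n => (integrable_const 1).indicator (hAm n)) (by
      refine hsum.summable.congr fun n => ?_
      rw [← hint]
      refine integral_congr_ae (ae_of_all _ fun ω => ?_)
      exact (Real.norm_of_nonneg (indicator_nonneg (fun _ _ => zero_le_one) ω)).symm)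
  simp_rw [hint] at hS
  rw [hsum.unique hS]
  refine integral_congr_ae ?_
  filter_upwards [ae_exists_fail h hK hp] with ω hω
  obtain ⟨k, hk, hk1⟩ := hω 0
  rw [zero_add] at hk1
  have hk0 : failCount (fun j => ξ j ω) k = 0 := by
    rw [failCount_succ, if_pos hk] at hk1
    omega
  have hn : numSucc (fun j => ξ j ω) 1 = k := by
    have := numSucc_add_of_fail (x := fun j => ξ j ω) hk hk1
    omega
  have hmem : ∀ n, ω ∈ A n ↔ n < k := by
    intro n
    constructor
    · intro hω
      by_contra! hkn
      have h2 := failCount_mono (fun j => ξ j ω) (Nat.succ_le_succ hkn)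
      have h3 : failCount (fun j => ξ j ω) (n + 1) = 0 := hω
      simp only [Nat.succ_eq_add_one] at h2
      omega
    · intro hnk
      exact Nat.le_zero.1 (hk0 ▸ failCount_mono _ hnk)
  rw [hn, tsum_eq_sum (s := Finset.range k) fun n hn => by
    rw [indicator_of_notMem]; rwa [hmem, ← Finset.mem_range]]
  rw [Finset.sum_congr rfl fun n hn =>
    indicator_of_mem ((hmem n).2 (Finset.mem_range.1 hn)) fun _ => (1 : ℝ)]
  simp

end CookieSite

/-- **Lemma 3.2.** The sequence `{I_m}` is a Markov chain on `R` with transition matrix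
`Π = (I − D_pK)⁻¹ D_{1−p} K` and unique stationary distribution `π = μ(I − D_pK)/(1 − p̄)`;
moreover, with `g(i) = E_i[G₁]` (`G₁ = S₁` the number of successes before the first failure,
started from state `i`), one has `𝐠 = (I − D_pK)⁻¹𝐩` and `π·𝐠 = λ = p̄/(1−p̄)`. -/
theorem Ichain_markov_stationary_and_g
    {N : ℕ} {Ω : Type*} [MeasurableSpace Ω]
    (K : Matrix (Fin N) (Fin N) ℝ) (μ p : Fin N → ℝ)
    (Rc : ℕ → Ω → Fin N) (ξ : ℕ → Ω → Bool)
    (Pfam : (Fin N → ℝ) → Measure Ω)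
    (hK : IsStochastic K) (hμ : HasUniqueStationaryDist K μ)
    (hp : ∀ i, p i ∈ Set.Ioo (0 : ℝ) 1)
    (henv : ∀ η : Fin N → ℝ, IsProbVec η →
      IsProbabilityMeasure (Pfam η) ∧ IsCookieSite (Pfam η) K p η Rc ξ) :
    -- `{I_m}` is a Markov chain with transition matrix `Π` (and initial distribution `η`)
    (∀ η : Fin N → ℝ, IsProbVec η → ∀ (m : ℕ) (f : ℕ → Fin N),
      (Pfam η {ω | ∀ j ≤ m, Ichain Rc ξ ω j = f j}).toReal =
        η (f 0) * ∏ j ∈ Finset.range m,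
          ((1 - Matrix.diagonal p * K)⁻¹ * (Matrix.diagonal (fun i => 1 - p i) * K))
            (f j) (f (j + 1))) ∧
    -- `π = μ(I − D_pK)/(1 − p̄)` is its unique stationary distribution
    (IsProbVec ((1 / (1 - ∑ i, μ i * p i)) • Matrix.vecMul μ (1 - Matrix.diagonal p * K)) ∧
      Matrix.vecMul ((1 / (1 - ∑ i, μ i * p i)) • Matrix.vecMul μ (1 - Matrix.diagonal p * K))
          ((1 - Matrix.diagonal p * K)⁻¹ * (Matrix.diagonal (fun i => 1 - p i) * K)) =
        (1 / (1 - ∑ i, μ i * p i)) • Matrix.vecMul μ (1 - Matrix.diagonal p * K) ∧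
      ∀ π' : Fin N → ℝ, IsProbVec π' →
        Matrix.vecMul π'
            ((1 - Matrix.diagonal p * K)⁻¹ * (Matrix.diagonal (fun i => 1 - p i) * K)) = π' →
        π' = (1 / (1 - ∑ i, μ i * p i)) • Matrix.vecMul μ (1 - Matrix.diagonal p * K)) ∧
    -- `𝐠 = (I − D_pK)⁻¹𝐩`, with `g(i) = E_i[G₁]`
    (∀ i : Fin N,
      (∫ ω, (numSucc (fun j => ξ j ω) 1 : ℝ)
          ∂Pfam (fun i' => if i' = i then 1 else 0)) =
        Matrix.mulVec (1 - Matrix.diagonal p * K)⁻¹ p i) ∧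
    -- `π·𝐠 = λ`
    (∑ i, ((1 / (1 - ∑ i', μ i' * p i')) • Matrix.vecMul μ (1 - Matrix.diagonal p * K)) i *
        Matrix.mulVec (1 - Matrix.diagonal p * K)⁻¹ p i) =
      (∑ i, μ i * p i) / (1 - ∑ i, μ i * p i) := by
  refine ⟨fun η hη m f => ?_, ⟨hμ.1.isProbVec_failure hK hp, hμ.1.failure_vecMul hK hp,
    fun π' hπ' hT => hμ.failure_unique hK hp hπ' hT⟩, fun i => ?_, ?_⟩
  · obtain ⟨_, h⟩ := henv η hη
    exact measureReal_forall_Ichain_eq h hK hp m f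
  · have hη : IsProbVec (fun i' => if i' = i then (1 : ℝ) else 0) :=
      ⟨fun i' => by dsimp only; split_ifs <;> norm_num, by simp⟩
    obtain ⟨_, h⟩ := henv _ hη
    rw [integral_numSucc_one h hK hp]
    simp [dotProduct]
  · change ((1 / (1 - ∑ i', μ i' * p i')) • Matrix.vecMul μ (1 - Matrix.diagonal p * K)) ⬝ᵥ
      ((1 - Matrix.diagonal p * K)⁻¹ *ᵥ p) = _
    rw [Matrix.dotProduct_mulVec, Matrix.smul_vecMul, Matrix.vecMul_vecMul,
      Matrix.mul_nonsing_inv _ (hK.isUnit_det hp), Matrix.vecMul_one, smul_dotProduct,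
      smul_eq_mul, one_div_mul_eq_div]
    rfl

end
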